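/- Let G be a connected finite simple graph of order n ≥ 3 with minimum degree δ(G) ≥ 2. Then the set of distinct complex roots of the total domination polynomial D_t(G,x) is exactly {−3, 0} if and only if G is isomorphic to the cycle C_3 or to the cycle C_6. -/

import Mathlib

open Polynomial

/-- `D` is a total dominating set of `G`: every vertex has a neighbor in `D`. -/
def SimpleGraph.IsTDS {V : Type*} (G : SimpleGraph V) (D : Finset V) : Prop :=
  ∀ v, ∃ u ∈ D, G.Adj v u

/-- `d_t(G,i)`: the number of total dominating sets of `G` of cardinality `i`. -/
noncomputable def SimpleGraph.dt {V : Type*} [Fintype V] (G : SimpleGraph V) (i : ℕ) : ℕ :=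
  Set.ncard {D : Finset V | D.card = i ∧ G.IsTDS D}

/-- The total domination polynomial `D_t(G,x) = Σ_{i=1}^{n} d_t(G,i) xⁱ` (over `ℂ`). -/
noncomputable def SimpleGraph.DtPoly {V : Type*} [Fintype V] (G : SimpleGraph V) :
    Polynomial ℂ :=
  ∑ i ∈ Finset.Icc 1 (Fintype.card V), Polynomial.C (G.dt i : ℂ) * Polynomial.X ^ i

/-- `w` is a support vertex of `G`: it is adjacent to a leaf (a vertex of degree one). -/
def SimpleGraph.IsSupportVertex {V : Type*} (G : SimpleGraph V) (w : V) : Prop :=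
  ∃ l, G.Adj w l ∧ G.neighborSet l = {w}

/-- The total domination number: minimum cardinality of a total dominating set. -/
noncomputable def SimpleGraph.gammaT {V : Type*} [Fintype V] (G : SimpleGraph V) : ℕ :=
  sInf {i | ∃ D : Finset V, D.card = i ∧ G.IsTDS D}

namespace SimpleGraph

open Finset

section Sets

variable {V W : Type*} {G : SimpleGraph V} {H : SimpleGraph W}

theorem IsTDS.map_iso (e : G ≃g H) {D : Finset V} (hD : G.IsTDS D) :
    H.IsTDS (D.map e.toEquiv.toEmbedding) := by
  intro w
  obtain ⟨u, hu, hadj⟩ := hD (e.symm w)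
  refine ⟨e u, mem_map_of_mem _ hu, ?_⟩
  have h := e.map_adj_iff.mpr hadj
  rwa [e.apply_symm_apply] at h

theorem not_isTDS_iff [Fintype V] [DecidableEq V] [DecidableRel G.Adj] {D : Finset V} :
    ¬ G.IsTDS D ↔ ∃ v, G.neighborFinset v ⊆ Dᶜ := by
  simp only [IsTDS, not_forall, not_exists, not_and, subset_iff, mem_neighborFinset, mem_compl]
  exact exists_congr fun v => forall_congr' fun u =>
    ⟨fun h ha hu => h hu ha, fun h hu ha => h ha hu⟩

theorem dt_eq_card_filter [Fintype V] (G : SimpleGraph V) [DecidablePred G.IsTDS] (i : ℕ) :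
    G.dt i = #{D ∈ powersetCard i (univ : Finset V) | G.IsTDS D} := by
  rw [dt, ← Set.ncard_coe_finset]
  congr 1
  ext D
  simp [mem_powersetCard]

theorem dt_le_of_iso [Fintype V] [Fintype W] (e : G ≃g H) (i : ℕ) : G.dt i ≤ H.dt i := by
  refine Set.ncard_le_ncard_of_injOn (fun D => D.map e.toEquiv.toEmbedding) ?_ ?_ (Set.toFinite _)
  · rintro D ⟨hc, hD⟩
    exact ⟨by simpa using hc, hD.map_iso e⟩
  · exact (Finset.map_injective _).injOn

theorem dt_congr_iso [Fintype V] [Fintype W] (e : G ≃g H) (i : ℕ) : G.dt i = H.dt i :=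
  le_antisymm (dt_le_of_iso e i) (dt_le_of_iso e.symm i)

theorem DtPoly_congr_iso [Fintype V] [Fintype W] (e : G ≃g H) : G.DtPoly = H.DtPoly := by
  simp only [DtPoly, Fintype.card_congr e.toEquiv, dt_congr_iso e]

theorem coeff_DtPoly [Fintype V] (G : SimpleGraph V) {i : ℕ} (h1 : 1 ≤ i)
    (h2 : i ≤ Fintype.card V) : G.DtPoly.coeff i = G.dt i := by
  simp only [DtPoly, finsetSum_coeff, coeff_C_mul, coeff_X_pow]
  rw [sum_eq_single i] <;> simp +contextual [eq_comm]
  omega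

theorem natDegree_DtPoly_le [Fintype V] (G : SimpleGraph V) :
    G.DtPoly.natDegree ≤ Fintype.card V :=
  natDegree_sum_le_of_forall_le _ _ fun _ hi =>
    (natDegree_C_mul_X_pow_le _ _).trans (mem_Icc.mp hi).2

end Sets

section Counting

variable {V : Type*} [Fintype V] {G : SimpleGraph V} [DecidableRel G.Adj]

theorem isTDS_of_card_compl_lt [DecidableEq V] {D : Finset V}
    (h : ∀ v, #Dᶜ < G.degree v) : G.IsTDS D := by
  by_contra hD
  obtain ⟨v, hv⟩ := not_isTDS_iff.mp hD
  exact (h v).not_ge (card_le_card hv)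

theorem dt_card_sub_of_lt_degree {k : ℕ} (hk : k ≤ Fintype.card V) (h : ∀ v, k < G.degree v) :
    G.dt (Fintype.card V - k) = (Fintype.card V).choose k := by
  classical
  rw [dt_eq_card_filter, filter_true_of_mem, card_powersetCard, card_univ, Nat.choose_symm hk]
  intro D hD v
  refine isTDS_of_card_compl_lt (fun v => ?_) v
  rw [card_compl, (mem_powersetCard.mp hD).2, Nat.sub_sub_self hk]
  exact h v

/-- When all degrees are at least `k`, the sets of size `n - k` that are not total dominating
are the complements of the neighborhoods of vertices of degree `k`. -/
theorem choose_le_dt_card_sub_add {k : ℕ} (hk : k ≤ Fintype.card V) (h : ∀ v, k ≤ G.degree v) :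
    (Fintype.card V).choose k ≤ G.dt (Fintype.card V - k) + #{v | G.degree v = k} := by
  classical
  rw [← Nat.choose_symm hk, ← card_univ, ← card_powersetCard, card_univ, dt_eq_card_filter,
    ← card_filter_add_card_filter_not (s := powersetCard _ univ) G.IsTDS]
  gcongr
  calc _ ≤ #(({v | G.degree v = k} : Finset V).image fun v => (G.neighborFinset v)ᶜ) := by
        refine card_le_card fun D hD => ?_
        obtain ⟨hD, hnot⟩ := mem_filter.mp hD
        obtain ⟨v, hv⟩ := not_isTDS_iff.mp hnot
        have hc : #Dᶜ = k := by
          rw [card_compl, (mem_powersetCard.mp hD).2, Nat.sub_sub_self hk]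
        have heq := eq_of_subset_of_card_le hv (hc.trans_le (h v))
        refine mem_image.mpr ⟨v, ?_, by rw [heq, compl_compl]⟩
        rw [mem_filter, ← card_neighborFinset_eq_degree, heq]
        exact ⟨mem_univ _, hc⟩
    _ ≤ _ := card_image_le

end Counting

section Cycle

theorem card_filter_mod_four_lt_two (n : ℕ) :
    #{i ∈ range n | i % 4 < 2} = 2 * (n / 4) + min (n % 4) 2 := by
  induction n with
  | zero => simp
  | succ n ih =>
    rw [range_add_one, filter_insert]
    split_ifs with h
    · rw [card_insert_of_notMem (by simp), ih]
      omega
    · rw [ih]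
      omega

theorem exists_isTDS_cycleGraph {n : ℕ} (hn : 3 ≤ n) :
    ∃ D : Finset (Fin n), (cycleGraph n).IsTDS D ∧ 2 * #D ≤ n + 2 := by
  refine ⟨univ.filter fun i => i.val % 4 < 2, fun v => ?_, ?_⟩
  · obtain ⟨n, rfl⟩ : ∃ m, n = m + 2 := ⟨n - 2, by omega⟩
    have hval := v.isLt
    by_cases hv : v.val % 4 = 0 ∨ v.val % 4 = 3
    · refine ⟨v + 1, ?_, by simp [cycleGraph_adj]⟩
      rw [mem_filter_univ, Fin.val_add_one]
      split_ifs
      · simp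
      · omega
    · refine ⟨v - 1, ?_, by simp [cycleGraph_adj]⟩
      rw [mem_filter_univ, Fin.val_sub_one_of_ne_zero (fun h0 => by simp [h0] at hv)]
      omega
  · have h := card_filter_mod_four_lt_two n
    rw [card_filter, ← Fin.sum_univ_eq_sum_range (fun i => if i % 4 < 2 then 1 else 0),
      ← card_filter] at h
    omega

variable {V : Type*} [Fintype V] {G : SimpleGraph V} [DecidableRel G.Adj]

theorem Connected.nonempty_iso_cycleGraph (hconn : G.Connected) (hn : 3 ≤ Fintype.card V)
    (hdeg : ∀ v, G.degree v = 2) : Nonempty (G ≃g cycleGraph (Fintype.card V)) := by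
  classical
  have hcyc : G.IsCycles := fun v _ => by
    rw [← coe_neighborFinset, Set.ncard_coe_finset, card_neighborFinset_eq_degree, hdeg]
  obtain ⟨v⟩ := hconn.nonempty
  obtain ⟨w, hw⟩ := (G.degree_pos_iff_exists_adj v).mp (by rw [hdeg]; norm_num)
  obtain ⟨p, hp, hverts⟩ := hcyc.exists_cycle_toSubgraph_verts_eq_connectedComponentSupp
    (c := G.connectedComponentMk v) rfl ⟨w, hw⟩
  have hham : p.IsHamiltonianCycle := by
    rw [Walk.isHamiltonianCycle_iff_isCycle_and_support_count_tail_eq_one]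
    refine ⟨hp, fun a => List.count_eq_one_of_mem hp.support_nodup ?_⟩
    have ha : a ∈ p.toSubgraph.verts := by
      rw [hverts, ConnectedComponent.mem_supp_iff, ConnectedComponent.eq]
      exact hconn.preconnected a v
    rw [Walk.mem_verts_toSubgraph, Walk.mem_support_iff] at ha
    rcases ha with rfl | ha
    · exact Walk.end_mem_tail_support hp.not_nil
    · exact ha
  obtain ⟨f⟩ := (cycleGraph_isContained_iff hn).mpr ⟨v, p, hp, hham.length_eq⟩
  have hbij : Function.Bijective f :=
    (Fintype.bijective_iff_injective_and_card f).mpr ⟨f.injective, by simp⟩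
  have hnbr (i : Fin (Fintype.card V)) :
      ((cycleGraph (Fintype.card V)).neighborFinset i).image f = G.neighborFinset (f i) := by
    refine eq_of_subset_of_card_le ?_ ?_
    · intro x hx
      obtain ⟨j, hj, rfl⟩ := mem_image.mp hx
      rw [mem_neighborFinset] at hj ⊢
      exact f.toHom.map_adj hj
    · rw [card_image_of_injective _ hbij.injective, card_neighborFinset_eq_degree,
        card_neighborFinset_eq_degree, hdeg]
      generalize Fintype.card V = n at hn i
      obtain ⟨n, rfl⟩ : ∃ m, n = m + 3 := ⟨n - 3, by omega⟩
      exact cycleGraph_degree_three_le.ge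
  refine ⟨Iso.symm ⟨Equiv.ofBijective f hbij, fun {i j} => ⟨fun hadj => ?_, f.toHom.map_adj⟩⟩⟩
  have hj : f j ∈ G.neighborFinset (f i) := (mem_neighborFinset ..).mpr hadj
  rw [← hnbr] at hj
  obtain ⟨k, hk, hkj⟩ := mem_image.mp hj
  rw [← f.injective hkj]
  exact (mem_neighborFinset ..).mp hk

instance [DecidableEq V] : DecidablePred G.IsTDS :=
  fun D => inferInstanceAs (Decidable (∀ v, ∃ u ∈ D, G.Adj v u))

theorem DtPoly_cycleGraph_three : (cycleGraph 3).DtPoly = X ^ 2 * (X + C 3) := by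
  have h1 : (cycleGraph 3).dt 1 = 0 := by rw [dt_eq_card_filter]; decide
  have h2 : (cycleGraph 3).dt 2 = 3 := by rw [dt_eq_card_filter]; decide
  have h3 : (cycleGraph 3).dt 3 = 1 := by rw [dt_eq_card_filter]; decide
  simp [DtPoly, sum_Icc_succ_top, h1, h2, h3]
  rw [show (C 3 : ℂ[X]) = 3 from rfl]
  ring

theorem DtPoly_cycleGraph_six : (cycleGraph 6).DtPoly = X ^ 4 * (X + C 3) ^ 2 := by
  have h1 : (cycleGraph 6).dt 1 = 0 := by rw [dt_eq_card_filter]; decide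
  have h2 : (cycleGraph 6).dt 2 = 0 := by rw [dt_eq_card_filter]; decide
  have h3 : (cycleGraph 6).dt 3 = 0 := by rw [dt_eq_card_filter]; decide +kernel
  have h4 : (cycleGraph 6).dt 4 = 9 := by rw [dt_eq_card_filter]; decide +kernel
  have h5 : (cycleGraph 6).dt 5 = 6 := by rw [dt_eq_card_filter]; decide +kernel
  have h6 : (cycleGraph 6).dt 6 = 1 := by rw [dt_eq_card_filter]; decide +kernel
  simp [DtPoly, sum_Icc_succ_top, h1, h2, h3, h4, h5, h6]
  rw [show (C 3 : ℂ[X]) = 3 from rfl]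
  ring

end Cycle

end SimpleGraph

theorem Polynomial.setOf_isRoot_X_pow_mul_X_add_C_pow {R : Type*} [CommRing R] [IsDomain R]
    (r : R) {a b : ℕ} (ha : a ≠ 0) (hb : b ≠ 0) :
    {z : R | (X ^ a * (X + C r) ^ b).IsRoot z} = {-r, 0} := by
  ext z
  simp [ha, hb, add_eq_zero_iff_eq_neg, or_comm]

theorem Polynomial.Monic.exists_eq_X_pow_mul_X_add_C_pow {K : Type*} [Field K] [IsAlgClosed K]
    {p : K[X]} (hp : p.Monic) {r : K} (hroots : ∀ z, p.IsRoot z → z = -r ∨ z = 0) :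
    ∃ a b, p = X ^ a * (X + C r) ^ b := by
  have hprod := (IsAlgClosed.splits p).eq_prod_roots_of_monic hp
  have hmem : ∀ z ∈ p.roots, z = -r ∨ z = 0 := fun z hz => hroots z (isRoot_of_mem_roots hz)
  rw [hprod]
  generalize p.roots = s at hmem
  induction s using Multiset.induction_on with
  | empty => exact ⟨0, 0, by simp⟩
  | cons z s ih =>
    obtain ⟨a, b, hab⟩ := ih fun w hw => hmem w (Multiset.mem_cons_of_mem hw)
    rw [Multiset.map_cons, Multiset.prod_cons, hab]
    rcases hmem z (Multiset.mem_cons_self z s) with rfl | rfl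
    · exact ⟨a, b + 1, by rw [C_neg]; ring⟩
    · exact ⟨a + 1, b, by rw [C_0]; ring⟩

/-- If all roots of `D_t(G,x)` lie in `{-3, 0}`, the three leading coefficients force `G` to be
2-regular of order `3m`, and `D_t(G,x) = x ^ (2m) (x + 3) ^ m`. -/
theorem SimpleGraph.exists_card_eq_three_mul_of_roots {V : Type*} [Fintype V] {G : SimpleGraph V}
    [DecidableRel G.Adj] (hcard : 3 ≤ Fintype.card V) (hdelta : ∀ v, 2 ≤ G.degree v)
    (hroots : ∀ z, G.DtPoly.IsRoot z → z = -3 ∨ z = 0) :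
    ∃ m, Fintype.card V = 3 * m ∧ (∀ v, G.degree v = 2) ∧
      G.DtPoly = X ^ (2 * m) * (X + C 3) ^ m := by
  have hn0 : G.dt (Fintype.card V) = 1 := by
    simpa using dt_card_sub_of_lt_degree (G := G) (Nat.zero_le _) fun v => by
      have := hdelta v; omega
  have hn1 : G.dt (Fintype.card V - 1) = Fintype.card V := by
    simpa using dt_card_sub_of_lt_degree (G := G) (k := 1) (by omega) hdelta
  have hn2 := choose_le_dt_card_sub_add (by omega) hdelta
  have hc0 := G.coeff_DtPoly (i := Fintype.card V) (by omega) le_rfl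
  have hc1 := G.coeff_DtPoly (i := Fintype.card V - 1) (by omega) (by omega)
  have hc2 := G.coeff_DtPoly (i := Fintype.card V - 2) (by omega) (by omega)
  rw [hn0, Nat.cast_one] at hc0
  rw [hn1] at hc1
  have hmonic : G.DtPoly.Monic := monic_of_natDegree_le_of_coeff_eq_one _ G.natDegree_DtPoly_le hc0
  obtain ⟨a, b, hab⟩ := hmonic.exists_eq_X_pow_mul_X_add_C_pow hroots
  have hdeg : a + b = Fintype.card V := by
    have h := natDegree_eq_of_le_of_coeff_ne_zero G.natDegree_DtPoly_le
      (by rw [hc0]; exact one_ne_zero)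
    rw [← h, hab, Monic.natDegree_mul (monic_X_pow a) ((monic_X_add_C 3).pow b),
      natDegree_X_pow, (monic_X_add_C (3 : ℂ)).natDegree_pow, natDegree_X_add_C, mul_one]
  have hb : Fintype.card V = 3 * b := by
    rw [hab, coeff_X_pow_mul', ← hdeg] at hc1
    rcases Nat.eq_zero_or_pos b with rfl | hb
    · rw [if_neg (by omega)] at hc1
      norm_cast at hc1
      omega
    · rw [if_pos (by omega), coeff_X_add_C_pow, show a + b - 1 - a = b - 1 by omega,
        Nat.choose_symm hb, Nat.choose_one_right, show b - (b - 1) = 1 by omega] at hc1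
      rw [← hdeg]
      exact_mod_cast hc1.symm
  have hdt2 : G.dt (Fintype.card V - 2) = 9 * b.choose 2 := by
    rw [hab, coeff_X_pow_mul', ← hdeg] at hc2
    rw [← hdeg]
    rcases Nat.lt_or_ge b 2 with hb2 | hb2
    · rw [if_neg (by omega)] at hc2
      rw [Nat.choose_eq_zero_of_lt hb2]
      exact_mod_cast hc2.symm
    · rw [if_pos (by omega), coeff_X_add_C_pow, show a + b - 2 - a = b - 2 by omega,
        Nat.choose_symm hb2, show b - (b - 2) = 2 by omega] at hc2
      have h : ((9 * b.choose 2 : ℕ) : ℂ) = (G.dt (a + b - 2) : ℂ) := by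
        rw [← hc2]; push_cast; ring
      exact_mod_cast h.symm
  refine ⟨b, hb, fun v => ?_, by rw [hab]; congr 2; omega⟩
  have hle : Fintype.card V ≤ (Finset.univ.filter fun v => G.degree v = 2).card := by
    rw [hdt2] at hn2
    have hchoose : (Fintype.card V).choose 2 = 9 * b.choose 2 + 3 * b := by
      rw [hb]
      have : (((3 * b).choose 2 : ℕ) : ℚ) = ((9 * b.choose 2 + 3 * b : ℕ) : ℚ) := by
        push_cast [Nat.cast_choose_two]
        ring
      exact_mod_cast this
    omega
  have huniv := Finset.eq_univ_of_card _ (le_antisymm (Finset.card_le_univ _) hle)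
  have hv := Finset.mem_univ v
  rw [← huniv] at hv
  exact (Finset.mem_filter.mp hv).2

/-- For a connected graph `G` of order `n ≥ 3` with minimum degree at least `2`, the set
of distinct complex roots of `D_t(G,x)` is exactly `{-3, 0}` if and only if `G` is
isomorphic to the cycle `C₃` or to the cycle `C₆`. -/
theorem stmt_17 {V : Type*} [Fintype V] (G : SimpleGraph V) [DecidableRel G.Adj]
    (hconn : G.Connected) (hcard : 3 ≤ Fintype.card V)
    (hdelta : ∀ v, 2 ≤ G.degree v) :
    {z : ℂ | G.DtPoly.IsRoot z} = {-3, 0} ↔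
      (Nonempty (G ≃g SimpleGraph.cycleGraph 3) ∨
        Nonempty (G ≃g SimpleGraph.cycleGraph 6)) := by
  constructor
  · intro h
    have hroots : ∀ z, G.DtPoly.IsRoot z → z = -3 ∨ z = 0 := fun z hz => h.subset hz
    obtain ⟨m, hm, hdeg, hpoly⟩ :=
      SimpleGraph.exists_card_eq_three_mul_of_roots hcard hdelta hroots
    obtain ⟨e⟩ := hconn.nonempty_iso_cycleGraph hcard hdeg
    obtain ⟨D, hD, hDcard⟩ := SimpleGraph.exists_isTDS_cycleGraph hcard
    have hzero : (SimpleGraph.cycleGraph (Fintype.card V)).dt D.card ≠ 0 :=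
      Set.ncard_ne_zero_of_mem (a := D) ⟨rfl, hD⟩
    have hne : D.Nonempty := by
      obtain ⟨v⟩ := hconn.nonempty
      obtain ⟨u, hu, -⟩ := hD (e v)
      exact ⟨u, hu⟩
    have hm2 : m < 3 := by
      by_contra! hlt
      have hc := G.coeff_DtPoly hne.card_pos (by omega)
      rw [hpoly, coeff_X_pow_mul', if_neg (by omega), SimpleGraph.dt_congr_iso e] at hc
      exact hzero (by exact_mod_cast hc.symm)
    obtain hm | hm : Fintype.card V = 3 ∨ Fintype.card V = 6 := by omega
    · exact .inl ⟨hm ▸ e⟩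
    · exact .inr ⟨hm ▸ e⟩
  · rintro (⟨⟨e⟩⟩ | ⟨⟨e⟩⟩)
    · rw [SimpleGraph.DtPoly_congr_iso e, SimpleGraph.DtPoly_cycleGraph_three, ← pow_one (X + C 3)]
      exact setOf_isRoot_X_pow_mul_X_add_C_pow 3 two_ne_zero one_ne_zero
    · rw [SimpleGraph.DtPoly_congr_iso e, SimpleGraph.DtPoly_cycleGraph_six]
      exact setOf_isRoot_X_pow_mul_X_add_C_pow 3 four_ne_zero two_ne_zero
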